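/- If R is a principal ideal domain, then the set {γ ∈ Γ : F ∩ γ(F) ≠ ∅} is finite; equivalently, every tile of the tessellation {γ(F) : γ ∈ Γ} intersects only finitely many other tiles. -/

import Mathlib

noncomputable section

open scoped Classical
open MeasureTheory

namespace Hilbert

/-- `k₀ = 2` if `k ≡ 1 (mod 4)` and `k₀ = 1` otherwise. -/
def k0 (k : ℕ) : ℝ := if k % 4 = 1 then 2 else 1

/-- `ω = (1 + √k)/k₀`. -/
def omg (k : ℕ) : ℝ := (1 + Real.sqrt k) / k0 k

/-- `ω' = (1 - √k)/k₀`, the algebraic conjugate of `ω`. -/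
def omg' (k : ℕ) : ℝ := (1 - Real.sqrt k) / k0 k

/-- The ring `R = ℤ[ω]`, realized inside `ℝ × ℝ` via the pair of real embeddings
`α ↦ (α, α')` of `K = ℚ(√k)`. -/
def R (k : ℕ) : Subring (ℝ × ℝ) := Subring.closure {(omg k, omg' k)}

/-- The ambient space `ℝ⁴`, with coordinates `(x₁, x₂, y₁, y₂)`. -/
abbrev Pt : Type := ℝ × ℝ × ℝ × ℝ

def x1 (p : Pt) : ℝ := p.1
def x2 (p : Pt) : ℝ := p.2.1
def y1 (p : Pt) : ℝ := p.2.2.1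
def y2 (p : Pt) : ℝ := p.2.2.2

/-- `H² × H²`, identified with an open subset of `ℝ⁴`. -/
def HH : Set Pt := {p | 0 < y1 p ∧ 0 < y2 p}

/-- The coordinate `s₁`, determined by `x₁ = s₁ + s₂ ω`, `x₂ = s₁ + s₂ ω'`. -/
def s1 (k : ℕ) (p : Pt) : ℝ := (omg' k * x1 p - omg k * x2 p) / (omg' k - omg k)

/-- The coordinate `s₂`. -/
def s2 (k : ℕ) (p : Pt) : ℝ := (x1 p - x2 p) / (omg k - omg' k)

/-- The ratio `r = y₁/y₂`. -/
def rr (p : Pt) : ℝ := y1 p / y2 p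

/-- The height `h = y₁ y₂`. -/
def hh (p : Pt) : ℝ := y1 p * y2 p

/-- `‖cZ+d‖ = ((cx₁+d)² + c²y₁²)((c'x₂+d')² + c'²y₂²)`, where `c = (c, c')`, `d = (d, d')`
are given by their two real embeddings. -/
def HNorm (c d : ℝ × ℝ) (p : Pt) : ℝ :=
  ((c.1 * x1 p + d.1) ^ 2 + c.1 ^ 2 * y1 p ^ 2) *
    ((c.2 * x2 p + d.2) ^ 2 + c.2 ^ 2 * y2 p ^ 2)

/-- `S = {(c,d) ∈ R² : cR + dR = R}`. -/
def Spairs (k : ℕ) : Set (R k × R k) := {cd | Ideal.span {cd.1, cd.2} = ⊤}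

/-- `V_{c,d}^≥ = {Z ∈ H²×H² : ‖cZ+d‖ ≥ 1}`. -/
def Vge (k : ℕ) (cd : R k × R k) : Set Pt :=
  {p ∈ HH | 1 ≤ HNorm (cd.1 : ℝ × ℝ) (cd.2 : ℝ × ℝ) p}

/-- `V_{c,d}^≤ = {Z ∈ H²×H² : ‖cZ+d‖ ≤ 1}`. -/
def Vle (k : ℕ) (cd : R k × R k) : Set Pt :=
  {p ∈ HH | HNorm (cd.1 : ℝ × ℝ) (cd.2 : ℝ × ℝ) p ≤ 1}

/-- `V_{c,d} = {Z ∈ H²×H² : ‖cZ+d‖ = 1}`. -/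
def Veq (k : ℕ) (cd : R k × R k) : Set Pt :=
  {p ∈ HH | HNorm (cd.1 : ℝ × ℝ) (cd.2 : ℝ × ℝ) p = 1}

/-- `F₀ = {Z ∈ H²×H² : ‖cZ+d‖ ≥ 1 for all (c,d) ∈ S}`. -/
def F0 (k : ℕ) : Set Pt :=
  {p ∈ HH | ∀ cd ∈ Spairs k, 1 ≤ HNorm (cd.1 : ℝ × ℝ) (cd.2 : ℝ × ℝ) p}

/-- `F_∞ = {(s₁,s₂,r,h) : |s₁| ≤ 1/2, |s₂| ≤ 1/2, ε₀⁻² ≤ r ≤ ε₀²}`, where `ε` stands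
for the fundamental unit `ε₀`. -/
def FInf (k : ℕ) (ε : ℝ) : Set Pt :=
  {p ∈ HH | |s1 k p| ≤ 1 / 2 ∧ |s2 k p| ≤ 1 / 2 ∧ (ε ^ 2)⁻¹ ≤ rr p ∧ rr p ≤ ε ^ 2}

/-- `F = F_∞ ∩ F₀`. -/
def F (k : ℕ) (ε : ℝ) : Set Pt := FInf k ε ∩ F0 k

/-- `SL₂(R)`. -/
abbrev SL (k : ℕ) := Matrix.SpecialLinearGroup (Fin 2) (R k)

/-- Möbius action on the upper half-plane: image of `x + y i` under `(a b; c d)`. -/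
def moeb (a b c d x y : ℝ) : ℝ × ℝ :=
  (((a * x + b) * (c * x + d) + a * c * y ^ 2) / ((c * x + d) ^ 2 + c ^ 2 * y ^ 2),
    y / ((c * x + d) ^ 2 + c ^ 2 * y ^ 2))

/-- The action of `γ ∈ SL₂(R)` on `H²×H²`: `γ` acts on the first factor through the first
embedding and through the conjugate matrix `γ'` (second embedding) on the second factor.
This descends to the Hilbert modular group `PSL₂(R)`. -/
def act (k : ℕ) (g : SL k) (p : Pt) : Pt :=
  ((moeb (g.1 0 0 : ℝ × ℝ).1 (g.1 0 1 : ℝ × ℝ).1 (g.1 1 0 : ℝ × ℝ).1 (g.1 1 1 : ℝ × ℝ).1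
      (x1 p) (y1 p)).1,
   (moeb (g.1 0 0 : ℝ × ℝ).2 (g.1 0 1 : ℝ × ℝ).2 (g.1 1 0 : ℝ × ℝ).2 (g.1 1 1 : ℝ × ℝ).2
      (x2 p) (y2 p)).1,
   (moeb (g.1 0 0 : ℝ × ℝ).1 (g.1 0 1 : ℝ × ℝ).1 (g.1 1 0 : ℝ × ℝ).1 (g.1 1 1 : ℝ × ℝ).1
      (x1 p) (y1 p)).2,
   (moeb (g.1 0 0 : ℝ × ℝ).2 (g.1 0 1 : ℝ × ℝ).2 (g.1 1 0 : ℝ × ℝ).2 (g.1 1 1 : ℝ × ℝ).2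
      (x2 p) (y2 p)).2)

/-- The pair of real embeddings of a unit of `R`. -/
def unitVal (k : ℕ) (u : (R k)ˣ) : ℝ × ℝ := ((u : R k) : ℝ × ℝ)

/-- `e` is the fundamental unit of `R`: the smallest unit of `R` greater than `1`
(with respect to the first embedding). -/
def IsFundUnit (k : ℕ) (e : (R k)ˣ) : Prop :=
  1 < (unitVal k e).1 ∧
    ∀ v : (R k)ˣ, 1 < (unitVal k v).1 → (unitVal k e).1 ≤ (unitVal k v).1

/-- The real number `ε₀ > 1`, the fundamental unit under the first embedding. -/
def eps (k : ℕ) (e : (R k)ˣ) : ℝ := (unitVal k e).1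


/-- The norm `N(c) = c c'` of an element of `R` (as a real number). -/
def Nm (k : ℕ) (c : R k) : ℝ := ((c : ℝ × ℝ)).1 * ((c : ℝ × ℝ)).2

/-- A subset `C` of `H²×H²` is hyperbolically bounded if it is bounded in the
Euclidean metric and `y₁, y₂ > ε` on `C` for some `ε > 0`. -/
def HypBounded (C : Set Pt) : Prop :=
  C ⊆ HH ∧ Bornology.IsBounded C ∧ ∃ ε > (0 : ℝ), ∀ p ∈ C, ε < y1 p ∧ ε < y2 p

/-- `V_{C,μ} = {(c,d) ∈ R × R : ‖cZ+d‖ ≤ μ for some Z ∈ C}`. -/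
def VCmu (k : ℕ) (C : Set Pt) (μ : ℝ) : Set (R k × R k) :=
  {cd | ∃ p ∈ C, HNorm (cd.1 : ℝ × ℝ) (cd.2 : ℝ × ℝ) p ≤ μ}

/-- The conditions (8) of Theorem `FiniteSides` on a pair `(c,d) ∈ R²`. -/
def SCond (k : ℕ) (ε : ℝ) (cd : R k × R k) : Prop :=
  cd.1 ≠ 0 ∧ Ideal.span {cd.1, cd.2} = ⊤ ∧
    |Nm k cd.1| ≤ 2 * k / (k0 k) ^ 2 ∧
    |((cd.2 : ℝ × ℝ)).1 / ((cd.1 : ℝ × ℝ)).1| <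
      ε * Real.sqrt (2 * k / (Nm k cd.1 ^ 2 * (k0 k) ^ 2) - (k0 k) ^ 2 / (2 * k)) +
        (1 + omg k) / 2 ∧
    |((cd.2 : ℝ × ℝ)).2 / ((cd.1 : ℝ × ℝ)).2| <
      ε * Real.sqrt (2 * k / (Nm k cd.1 ^ 2 * (k0 k) ^ 2) - (k0 k) ^ 2 / (2 * k)) +
        (1 - omg' k) / 2

/-- `S₁` is a set of representatives, up to multiplication by units of `R`, of the pairs
`(c,d) ∈ R²` satisfying the conditions `SCond`. -/
def IsRepSet (k : ℕ) (ε : ℝ) (S1 : Set (R k × R k)) : Prop :=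
  (∀ cd ∈ S1, SCond k ε cd) ∧
    (∀ cd : R k × R k, SCond k ε cd →
      ∃ ab ∈ S1, ∃ u : (R k)ˣ, cd.1 = (u : R k) * ab.1 ∧ cd.2 = (u : R k) * ab.2) ∧
    (∀ ab ∈ S1, ∀ ab' ∈ S1,
      (∃ u : (R k)ˣ, ab'.1 = (u : R k) * ab.1 ∧ ab'.2 = (u : R k) * ab.2) → ab = ab')

/-- The family `𝒱_∞ = {V_i^± : i = 1,2,3}`. -/
def VfamInf (k : ℕ) (ε : ℝ) : Set (Set Pt) :=
  { {p ∈ HH | s1 k p = 1 / 2}, {p ∈ HH | s1 k p = -(1 / 2)},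
    {p ∈ HH | s2 k p = 1 / 2}, {p ∈ HH | s2 k p = -(1 / 2)},
    {p ∈ HH | rr p = ε ^ 2}, {p ∈ HH | rr p = (ε ^ 2)⁻¹} }

/-- The family `𝒱 = {V_{c,d} : (c,d) ∈ S, c ≠ 0}`. -/
def Vfam (k : ℕ) : Set (Set Pt) :=
  {V | ∃ cd ∈ Spairs k, cd.1 ≠ 0 ∧ V = Veq k cd}

/-- The family `𝓜 = {γ(M) : γ ∈ Γ, M ∈ 𝒱 ∪ 𝒱_∞}`. -/
def Mfam (k : ℕ) (ε : ℝ) : Set (Set Pt) :=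
  {M | ∃ g : SL k, ∃ V ∈ Vfam k ∪ VfamInf k ε, M = act k g '' V}

/-- `ω` as an element of `R`. -/
def omR (k : ℕ) : R k := ⟨(omg k, omg' k), Subring.subset_closure rfl⟩

/-- The side-pairing transformations: `γ ≠ 1` (in `PSL₂(R)`) such that `F ∩ γ⁻¹(F)` has
Hausdorff dimension `3`. -/
def SidePairings (k : ℕ) (ε : ℝ) : Set (SL k) :=
  {g | g ≠ 1 ∧ g.1 ≠ -1 ∧ dimH (F k ε ∩ act k g⁻¹ '' F k ε) = 3}


theorem aux_omg (k : ℕ) : ∃ t s : ℤ, omg k + omg' k = t ∧ omg k * omg' k = -s := by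
  have hs : Real.sqrt k * Real.sqrt k = k := Real.mul_self_sqrt (Nat.cast_nonneg k)
  by_cases h : k % 4 = 1
  · refine ⟨1, k / 4, ?_, ?_⟩
    · simp only [omg, omg', k0, if_pos h]; push_cast; ring
    · have h2 : (k : ℝ) = 4 * ((k / 4 : ℕ) : ℝ) + 1 := by
        have : k = 4 * (k / 4) + 1 := by omega
        exact_mod_cast this
      have h3 : (((k : ℤ) / 4 : ℤ) : ℝ) = ((k / 4 : ℕ) : ℝ) := by norm_cast
      rw [h3]
      simp only [omg, omg', k0, if_pos h]
      nlinarith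
  · refine ⟨2, k - 1, ?_, ?_⟩
    · simp only [omg, omg', k0, if_neg h]; push_cast; ring
    · simp only [omg, omg', k0, if_neg h]; push_cast; nlinarith

theorem aux_diff (k : ℕ) (hk1 : 1 < k) : 1 ≤ omg k - omg' k := by
  have h1 : 1 ≤ Real.sqrt k := by
    rw [Real.one_le_sqrt]; exact_mod_cast hk1.le
  by_cases h : k % 4 = 1
  · simp only [omg, omg', k0, if_pos h]; linarith
  · simp only [omg, omg', k0, if_neg h]; linarith

theorem aux_rep (k : ℕ) (a : R k) : ∃ m n : ℤ,
    (a : ℝ × ℝ).1 = m + n * omg k ∧ (a : ℝ × ℝ).2 = m + n * omg' k := by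
  obtain ⟨t, s, ht, hs⟩ := aux_omg k
  have h1 : omg k * omg k = t * omg k + s := by
    have : omg' k = t - omg k := by linarith
    rw [this] at hs; linarith
  have h2 : omg' k * omg' k = t * omg' k + s := by
    have : omg k = t - omg' k := by linarith
    rw [this] at hs; linarith
  obtain ⟨a, ha⟩ := a
  simp only
  induction ha using Subring.closure_induction with
  | mem x hx =>
    rw [Set.mem_singleton_iff] at hx
    subst hx
    exact ⟨0, 1, by simp, by simp⟩
  | zero => exact ⟨0, 0, by simp, by simp⟩
  | one => exact ⟨1, 0, by simp, by simp⟩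
  | add x y _ _ hx hy =>
    obtain ⟨m, n, h, h'⟩ := hx
    obtain ⟨m2, n2, h3, h4⟩ := hy
    refine ⟨m + m2, n + n2, ?_, ?_⟩
    · rw [Prod.fst_add, h, h3]; push_cast; ring
    · rw [Prod.snd_add, h', h4]; push_cast; ring
  | neg x _ hx =>
    obtain ⟨m, n, h, h'⟩ := hx
    refine ⟨-m, -n, ?_, ?_⟩
    · rw [Prod.fst_neg, h]; push_cast; ring
    · rw [Prod.snd_neg, h']; push_cast; ring
  | mul x y _ _ hx hy =>
    obtain ⟨m, n, h, h'⟩ := hx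
    obtain ⟨m2, n2, h3, h4⟩ := hy
    refine ⟨m * m2 + n * n2 * s, m * n2 + n * m2 + n * n2 * t, ?_, ?_⟩
    · rw [Prod.fst_mul, h, h3]; push_cast; linear_combination (n * n2 : ℝ) * h1
    · rw [Prod.snd_mul, h', h4]; push_cast; linear_combination (n * n2 : ℝ) * h2

theorem aux_irr (k : ℕ) (hk : Squarefree k) (hk1 : 1 < k) : Irrational (Real.sqrt k) := by
  rw [irrational_sqrt_natCast_iff]
  rintro ⟨r, hr⟩
  have h := hk r (by rw [hr])
  rw [Nat.isUnit_iff] at h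
  subst h
  omega

theorem aux_omg_irr (k : ℕ) (hk : Squarefree k) (hk1 : 1 < k) :
    Irrational (omg k) ∧ Irrational (omg' k) := by
  have h := aux_irr k hk hk1
  by_cases h4 : k % 4 = 1
  · simp only [omg, omg', k0, if_pos h4]
    constructor
    · have := ((h.ratCast_add 1).div_ratCast (q := 2) (by norm_num))
      simpa using this
    · have := ((h.ratCast_sub 1).div_ratCast (q := 2) (by norm_num))
      simpa using this
  · simp only [omg, omg', k0, if_neg h4, div_one]
    constructor
    · have := (h.ratCast_add 1)
      simpa using this
    · have := (h.ratCast_sub 1)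
      simpa using this

theorem aux_lin {w : ℝ} (hw : Irrational w) {m n : ℤ} (h : (m : ℝ) + n * w = 0) :
    m = 0 ∧ n = 0 := by
  have hn : n = 0 := by
    by_contra hn
    have h2 := (hw.intCast_mul hn).intCast_add m
    rw [h] at h2
    exact h2.ne_zero rfl
  subst hn
  simp at h
  exact ⟨h, rfl⟩

theorem aux_ne (k : ℕ) (hk : Squarefree k) (hk1 : 1 < k) (a : R k) (ha : a ≠ 0) :
    (a : ℝ × ℝ).1 ≠ 0 ∧ (a : ℝ × ℝ).2 ≠ 0 ∧
      1 ≤ ((a : ℝ × ℝ).1 * (a : ℝ × ℝ).2) ^ 2 := by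
  obtain ⟨m, n, h1, h2⟩ := aux_rep k a
  obtain ⟨i1, i2⟩ := aux_omg_irr k hk hk1
  have key : ¬ (m = 0 ∧ n = 0) := by
    rintro ⟨rfl, rfl⟩
    apply ha
    apply Subtype.ext
    apply Prod.ext
    · rw [h1]; simp
    · rw [h2]; simp
  have n1 : (a : ℝ × ℝ).1 ≠ 0 := fun h => key (aux_lin i1 (h1 ▸ h))
  have n2 : (a : ℝ × ℝ).2 ≠ 0 := fun h => key (aux_lin i2 (h2 ▸ h))
  refine ⟨n1, n2, ?_⟩
  obtain ⟨t, s, ht, hs⟩ := aux_omg k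
  have e : (a : ℝ × ℝ).1 * (a : ℝ × ℝ).2 = ((m * m + m * n * t - n * n * s : ℤ) : ℝ) := by
    rw [h1, h2]; push_cast
    linear_combination (m * n : ℝ) * ht + (n * n : ℝ) * hs
  have hne := mul_ne_zero n1 n2
  rw [e] at hne ⊢
  have hz : (m * m + m * n * t - n * n * s : ℤ) ≠ 0 := by exact_mod_cast hne
  have : 1 ≤ (m * m + m * n * t - n * n * s : ℤ) ^ 2 := by
    have := sq_pos_of_ne_zero hz
    omega
  exact_mod_cast this

theorem aux_fin (k : ℕ) (hk1 : 1 < k) (B : ℝ) :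
    {a : R k | |(a : ℝ × ℝ).1| ≤ B ∧ |(a : ℝ × ℝ).2| ≤ B}.Finite := by
  have hd := aux_diff k hk1
  choose m n h1 h2 using aux_rep k
  set C := ⌈B + 2 * B * |omg k|⌉ with hC
  set C2 := ⌈2 * B⌉ with hC2
  have hfin : ((Set.Icc (-C) C) ×ˢ (Set.Icc (-C2) C2) : Set (ℤ × ℤ)).Finite :=
    (Set.finite_Icc _ _).prod (Set.finite_Icc _ _)
  refine Set.Finite.of_finite_image (f := fun a => (m a, n a)) (hfin.subset ?_) ?_
  · rintro _ ⟨a, ⟨ha1, ha2⟩, rfl⟩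
    have hn : |(n a : ℝ)| ≤ 2 * B := by
      have e : (n a : ℝ) * (omg k - omg' k) = (a : ℝ × ℝ).1 - (a : ℝ × ℝ).2 := by
        rw [h1, h2]; ring
      have : |(n a : ℝ)| * 1 ≤ |(n a : ℝ) * (omg k - omg' k)| := by
        rw [abs_mul]
        exact mul_le_mul_of_nonneg_left (hd.trans (le_abs_self _)) (abs_nonneg _)
      rw [e] at this
      have := abs_sub (a : ℝ × ℝ).1 (a : ℝ × ℝ).2
      linarith
    have hm : |(m a : ℝ)| ≤ B + 2 * B * |omg k| := by
      have e : (m a : ℝ) = (a : ℝ × ℝ).1 - n a * omg k := by rw [h1]; ring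
      rw [e]
      have h3 := abs_sub (a : ℝ × ℝ).1 (n a * omg k)
      rw [abs_mul] at h3
      have := mul_le_mul_of_nonneg_right hn (abs_nonneg (omg k))
      linarith
    have hm' := abs_le.1 (hm.trans (Int.le_ceil _))
    have hn' := abs_le.1 (hn.trans (Int.le_ceil _))
    refine ⟨⟨?_, ?_⟩, ⟨?_, ?_⟩⟩
    · exact_mod_cast hm'.1
    · exact_mod_cast hm'.2
    · exact_mod_cast hn'.1
    · exact_mod_cast hn'.2
  · intro a _ b _ hab
    simp only [Prod.mk.injEq] at hab
    apply Subtype.ext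
    apply Prod.ext
    · rw [h1, h1, hab.1, hab.2]
    · rw [h2, h2, hab.1, hab.2]

def mkR (k : ℕ) (m n : ℤ) : R k := (m : R k) + (n : R k) * omR k

theorem mkR_fst (k : ℕ) (m n : ℤ) : (mkR k m n : ℝ × ℝ).1 = m + n * omg k := by
  simp [mkR, omR]

theorem mkR_snd (k : ℕ) (m n : ℤ) : (mkR k m n : ℝ × ℝ).2 = m + n * omg' k := by
  simp [mkR, omR]

theorem aux_absb {u v w U : ℝ} (hu : |u| ≤ U) (hv : |v| ≤ U) (hU : 0 ≤ U) {C : ℝ}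
    (hC : 1 + |w| ≤ C) : |u + v * w| ≤ C * U := by
  have h := abs_add_le u (v * w)
  rw [abs_mul] at h
  have := mul_le_mul_of_nonneg_right hv (abs_nonneg w)
  nlinarith

theorem aux_dirichlet (k : ℕ) (hk1 : 1 < k) (C : ℝ) (hC1 : 1 + |omg k| ≤ C)
    (hC2 : 1 + |omg' k| ≤ C) (N : ℕ) (hN : 0 < N) (x x' : ℝ) :
    ∃ c d : R k, c ≠ 0 ∧ |(c : ℝ × ℝ).1| ≤ C * N ∧ |(c : ℝ × ℝ).2| ≤ C * N ∧
      |(c : ℝ × ℝ).1 * x + (d : ℝ × ℝ).1| ≤ C * (1 / N) ∧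
      |(c : ℝ × ℝ).2 * x' + (d : ℝ × ℝ).2| ≤ C * (1 / N) := by
  have hd := aux_diff k hk1
  have hNR : (0 : ℝ) < N := by exact_mod_cast hN
  have hdec : ∀ w w' : ℝ, ∃ s t : ℝ, w = s + t * omg k ∧ w' = s + t * omg' k := by
    intro w w'
    refine ⟨w - (w - w') / (omg k - omg' k) * omg k, (w - w') / (omg k - omg' k), by ring, ?_⟩
    have : omg k - omg' k ≠ 0 := by linarith
    field_simp
    ring
  have hdec2 : ∀ mn : ℕ × ℕ, ∃ s t : ℝ, (mn.1 + mn.2 * omg k) * x = s + t * omg k ∧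
      (mn.1 + mn.2 * omg' k) * x' = s + t * omg' k := fun mn => hdec _ _
  choose s t hs ht using hdec2
  let f : ℕ × ℕ → ℤ × ℤ := fun mn => (⌊N * Int.fract (s mn)⌋, ⌊N * Int.fract (t mn)⌋)
  have hfl : ∀ z : ℝ, ⌊N * Int.fract z⌋ ∈ Finset.Ico (0 : ℤ) N := by
    intro z
    rw [Finset.mem_Ico]
    constructor
    · exact Int.floor_nonneg.2 (mul_nonneg hNR.le (Int.fract_nonneg _))
    · rw [Int.floor_lt]
      have := Int.fract_lt_one z
      push_cast
      nlinarith
  have hcard : ((Finset.Ico (0 : ℤ) N) ×ˢ (Finset.Ico (0 : ℤ) N)).card <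
      ((Finset.range (N + 1)) ×ˢ (Finset.range (N + 1))).card := by
    simp only [Finset.card_product, Int.card_Ico, Finset.card_range, sub_zero, Int.toNat_natCast]
    nlinarith
  obtain ⟨p, hp, q, hq, hpq, hf⟩ := Finset.exists_ne_map_eq_of_card_lt_of_maps_to (f := f) hcard
    (fun mn _ => Finset.mem_product.2 ⟨hfl _, hfl _⟩)
  simp only [f, Prod.mk.injEq] at hf
  rw [Finset.mem_product, Finset.mem_range, Finset.mem_range] at hp hq
  have hb : ∀ a b : ℕ, a < N + 1 → b < N + 1 → |(((a : ℤ) - b : ℤ) : ℝ)| ≤ N := by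
    intro a b ha hb
    have : |(a : ℤ) - b| ≤ N := by rw [abs_le]; omega
    exact_mod_cast this
  have hfr : ∀ z z' : ℝ, ⌊N * Int.fract z⌋ = ⌊N * Int.fract z'⌋ →
      |Int.fract z - Int.fract z'| ≤ 1 / N := by
    intro z z' h
    have h2 := Int.abs_sub_lt_one_of_floor_eq_floor h
    rw [← mul_sub, abs_mul, abs_of_pos hNR] at h2
    rw [le_div_iff₀ hNR]
    linarith
  have hfs := hfr _ _ hf.1
  have hft := hfr _ _ hf.2
  refine ⟨mkR k ((p.1 : ℤ) - q.1) ((p.2 : ℤ) - q.2),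
    mkR k (⌊s q⌋ - ⌊s p⌋) (⌊t q⌋ - ⌊t p⌋), ?_, ?_, ?_, ?_, ?_⟩
  · intro h0
    have e1 := mkR_fst k ((p.1 : ℤ) - q.1) ((p.2 : ℤ) - q.2)
    have e2 := mkR_snd k ((p.1 : ℤ) - q.1) ((p.2 : ℤ) - q.2)
    rw [h0] at e1 e2
    simp only [ZeroMemClass.coe_zero, Prod.fst_zero, Prod.snd_zero] at e1 e2
    have h3 : (((p.2 : ℤ) - q.2 : ℤ) : ℝ) * (omg k - omg' k) = 0 := by linarith
    have h4 : (((p.2 : ℤ) - q.2 : ℤ) : ℝ) = 0 := by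
      rcases mul_eq_zero.1 h3 with h | h
      · exact h
      · linarith
    rw [h4, zero_mul, add_zero] at e1
    have h4' : (p.2 : ℤ) - q.2 = 0 := by exact_mod_cast h4
    have h5' : (p.1 : ℤ) - q.1 = 0 := by exact_mod_cast e1.symm
    exact hpq (Prod.ext (by omega) (by omega))
  · rw [mkR_fst]
    exact aux_absb (hb _ _ hp.1 hq.1) (hb _ _ hp.2 hq.2) hNR.le hC1
  · rw [mkR_snd]
    exact aux_absb (hb _ _ hp.1 hq.1) (hb _ _ hp.2 hq.2) hNR.le hC2
  · have e : (mkR k ((p.1 : ℤ) - q.1) ((p.2 : ℤ) - q.2) : ℝ × ℝ).1 * x +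
        (mkR k (⌊s q⌋ - ⌊s p⌋) (⌊t q⌋ - ⌊t p⌋) : ℝ × ℝ).1 =
        (Int.fract (s p) - Int.fract (s q)) + (Int.fract (t p) - Int.fract (t q)) * omg k := by
      rw [mkR_fst, mkR_fst]
      simp only [Int.fract]
      push_cast
      linear_combination hs p - hs q
    rw [e]
    exact aux_absb hfs hft (by positivity) hC1
  · have e : (mkR k ((p.1 : ℤ) - q.1) ((p.2 : ℤ) - q.2) : ℝ × ℝ).2 * x' +
        (mkR k (⌊s q⌋ - ⌊s p⌋) (⌊t q⌋ - ⌊t p⌋) : ℝ × ℝ).2 =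
        (Int.fract (s p) - Int.fract (s q)) + (Int.fract (t p) - Int.fract (t q)) * omg' k := by
      rw [mkR_snd, mkR_snd]
      simp only [Int.fract]
      push_cast
      linear_combination ht p - ht q
    rw [e]
    exact aux_absb hfs hft (by positivity) hC2

theorem aux_norm (k : ℕ) (hk : Squarefree k) (hk1 : 1 < k) (hPID : IsPrincipalIdealRing (R k))
    (p : Pt) (hp : p ∈ F0 k) (c d : R k) (hc : c ≠ 0) :
    1 ≤ HNorm (c : ℝ × ℝ) (d : ℝ × ℝ) p := by
  obtain ⟨g, hg⟩ := (hPID.principal (Ideal.span {c, d})).principal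
  change Ideal.span {c, d} = Ideal.span {g} at hg
  have hcg : c ∈ Ideal.span {g} := hg ▸ Ideal.subset_span (by simp)
  have hdg : d ∈ Ideal.span {g} := hg ▸ Ideal.subset_span (by simp)
  have hgg : g ∈ Ideal.span {c, d} := hg ▸ Ideal.subset_span (by simp)
  obtain ⟨c0, rfl⟩ := Ideal.mem_span_singleton'.1 hcg
  obtain ⟨d0, rfl⟩ := Ideal.mem_span_singleton'.1 hdg
  obtain ⟨u, v, huv⟩ := Ideal.mem_span_pair.1 hgg
  have hg0 : g ≠ 0 := by rintro rfl; simp at hc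
  obtain ⟨g1, g2, gn⟩ := aux_ne k hk hk1 g hg0
  have h1 : u * c0 + v * d0 = 1 := by
    by_contra hne
    have h0 := aux_ne k hk hk1 (u * c0 + v * d0 - 1) (sub_ne_zero.2 hne)
    have e : (u * c0 + v * d0 - 1) * g = 0 := by linear_combination huv
    have e1 := congrArg (fun z : R k => (z : ℝ × ℝ).1) e
    simp only [Subring.coe_mul, Prod.fst_mul, ZeroMemClass.coe_zero, Prod.fst_zero] at e1
    exact mul_ne_zero h0.1 g1 e1
  have hS : (c0, d0) ∈ Spairs k := by
    simp only [Spairs, Set.mem_ofPred_eq]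
    rw [Ideal.eq_top_iff_one]
    exact Ideal.mem_span_pair.2 ⟨u, v, h1⟩
  have h2 := hp.2 _ hS
  have e : HNorm ((c0 * g : R k) : ℝ × ℝ) ((d0 * g : R k) : ℝ × ℝ) p =
      ((g : ℝ × ℝ).1 * (g : ℝ × ℝ).2) ^ 2 * HNorm (c0 : ℝ × ℝ) (d0 : ℝ × ℝ) p := by
    simp only [HNorm, Subring.coe_mul, Prod.fst_mul, Prod.snd_mul]
    ring
  rw [e]
  simp only at h2
  nlinarith

theorem aux_height (k : ℕ) (hk : Squarefree k) (hk1 : 1 < k) (hPID : IsPrincipalIdealRing (R k))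
    (ε : ℝ) (hε : 1 < ε) : ∃ h0 : ℝ, 0 < h0 ∧ ∀ p ∈ F k ε, h0 ≤ y1 p ^ 2 ∧ h0 ≤ y2 p ^ 2 := by
  set C : ℝ := 1 + |omg k| + |omg' k| with hC
  have a1 := abs_nonneg (omg k)
  have a2 := abs_nonneg (omg' k)
  have hCp : 1 ≤ C := by linarith
  obtain ⟨N, hN⟩ := exists_nat_gt (2 * C)
  have hNR : (0 : ℝ) < N := by linarith
  have hN0 : 0 < N := by exact_mod_cast hNR
  have hε2 : 0 < ε ^ 2 := by positivity
  set M : ℝ := C ^ 2 * N ^ 2 with hM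
  have hMp : 0 < M := by positivity
  refine ⟨1 / (4 * M * ε ^ 4), by positivity, ?_⟩
  intro p hp
  obtain ⟨⟨⟨hy1, hy2⟩, -, -, hr1, hr2⟩, hF0⟩ := hp
  obtain ⟨c, d, hc, hc1, hc2, hd1, hd2⟩ := aux_dirichlet k hk1 C (by linarith) (by linarith) N hN0
    (x1 p) (x2 p)
  have hn := aux_norm k hk hk1 hPID p hF0 c d hc
  have hy12 : y1 p ≤ ε ^ 2 * y2 p := by
    rw [rr, div_le_iff₀ hy2] at hr2; exact hr2
  have hy21 : y2 p ≤ ε ^ 2 * y1 p := by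
    rw [rr, le_div_iff₀ hy2, inv_mul_le_iff₀ hε2] at hr1; exact hr1
  have hsm : ∀ z : ℝ, |z| ≤ C * (1 / N) → z ^ 2 ≤ 1 / 4 := by
    intro z hz
    have h2 : C * (1 / N) ≤ 1 / 2 := by
      rw [mul_one_div, div_le_iff₀ hNR]; linarith
    have h3 := sq_le_sq' (by linarith [abs_le.1 (hz.trans h2)]) (abs_le.1 (hz.trans h2)).2
    linarith
  have hcm : ∀ z : ℝ, |z| ≤ C * N → z ^ 2 ≤ M := by
    intro z hz
    have h3 := sq_le_sq' (abs_le.1 hz).1 (abs_le.1 hz).2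
    rw [hM]; linarith [mul_pow C (N : ℝ) 2]
  have hS1 := hsm _ hd1
  have hS2 := hsm _ hd2
  have hM1 := hcm _ hc1
  have hM2 := hcm _ hc2
  -- if both were small then the norm is < 1
  have key : ∀ Y : ℝ, y1 p ^ 2 ≤ Y → y2 p ^ 2 ≤ Y → 1 ≤ 4 * M * Y := by
    intro Y hY1 hY2
    by_contra hcon
    push Not at hcon
    have hY : 0 ≤ Y := (sq_nonneg _).trans hY1
    have b1 : (c : ℝ × ℝ).1 ^ 2 * y1 p ^ 2 ≤ M * Y :=
      mul_le_mul hM1 hY1 (sq_nonneg _) hMp.le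
    have b2 : (c : ℝ × ℝ).2 ^ 2 * y2 p ^ 2 ≤ M * Y :=
      mul_le_mul hM2 hY2 (sq_nonneg _) hMp.le
    have p1 : 0 ≤ (c : ℝ × ℝ).1 ^ 2 * y1 p ^ 2 := by positivity
    have p2 : 0 ≤ (c : ℝ × ℝ).2 ^ 2 * y2 p ^ 2 := by positivity
    have t1 : ((c : ℝ × ℝ).1 * x1 p + (d : ℝ × ℝ).1) ^ 2 + (c : ℝ × ℝ).1 ^ 2 * y1 p ^ 2 ≤ 1 / 2 := by
      linarith
    have t2 : ((c : ℝ × ℝ).2 * x2 p + (d : ℝ × ℝ).2) ^ 2 + (c : ℝ × ℝ).2 ^ 2 * y2 p ^ 2 ≤ 1 / 2 := by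
      linarith
    have t3 := mul_le_mul t1 t2 (by positivity) (by norm_num)
    rw [HNorm] at hn
    linarith
  have hε4 : 1 ≤ ε ^ 4 := one_le_pow₀ hε.le
  have q12 : y1 p ^ 2 ≤ ε ^ 4 * y2 p ^ 2 := by
    have := pow_le_pow_left₀ hy1.le hy12 2
    rw [mul_pow, ← pow_mul] at this
    exact this
  have q21 : y2 p ^ 2 ≤ ε ^ 4 * y1 p ^ 2 := by
    have := pow_le_pow_left₀ hy2.le hy21 2
    rw [mul_pow, ← pow_mul] at this
    exact this
  constructor
  · rw [div_le_iff₀ (by positivity)]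
    have := key (ε ^ 4 * y1 p ^ 2) (le_mul_of_one_le_left (sq_nonneg _) hε4) q21
    linarith
  · rw [div_le_iff₀ (by positivity)]
    have := key (ε ^ 4 * y2 p ^ 2) q12 (le_mul_of_one_le_left (sq_nonneg _) hε4)
    linarith

theorem aux_den {a b c d x y : ℝ} (hy : 0 < y) (hdet : a * d - b * c = 1) :
    0 < (c * x + d) ^ 2 + c ^ 2 * y ^ 2 := by
  by_cases hc : c = 0
  · subst hc
    have : d ≠ 0 := by rintro rfl; simp at hdet
    simp only [zero_mul, zero_add]
    positivity
  · positivity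

/-- inverse factor -/
theorem aux_inv {a b c d x y : ℝ} (hy : 0 < y) (hdet : a * d - b * c = 1) :
    ((-c) * (moeb a b c d x y).1 + a) ^ 2 + (-c) ^ 2 * (moeb a b c d x y).2 ^ 2 =
      1 / ((c * x + d) ^ 2 + c ^ 2 * y ^ 2) := by
  have hD := aux_den (x := x) hy hdet
  simp only [moeb]
  set D := (c * x + d) ^ 2 + c ^ 2 * y ^ 2 with hDd
  have e : (-c) * (((a * x + b) * (c * x + d) + a * c * y ^ 2) / D) + a = (c * x + d) / D := by
    field_simp
    rw [hDd]
    linear_combination (c * x + d) * hdet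
  rw [e]
  field_simp
  rw [hDd]

theorem aux_entries {a b c d x y ε η B : ℝ} (hy : 0 < y) (hη : 0 < η) (hε : 1 < ε)
    (hdet : a * d - b * c = 1)
    (hx : |x| ≤ B) (hX : |(moeb a b c d x y).1| ≤ B)
    (hD : (c * x + d) ^ 2 + c ^ 2 * y ^ 2 ≤ ε ^ 2)
    (hD' : 1 / ((c * x + d) ^ 2 + c ^ 2 * y ^ 2) ≤ ε ^ 2)
    (hc : c = 0 ∨ (η ≤ y ∧ (moeb a b c d x y).2 ≤ ε)) :
    |c| ≤ ε / η ∧ |d| ≤ ε + ε / η * B ∧ |a| ≤ ε + ε / η * B ∧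
      |b| ≤ ε * B + ε ^ 2 + (ε + ε / η * B) * B := by
  have hB : 0 ≤ B := (abs_nonneg _).trans hx
  have hinv := aux_inv (x := x) hy hdet
  have hDp := aux_den (x := x) hy hdet
  have eb : b = (moeb a b c d x y).1 * (c * x + d) - (moeb a b c d x y).2 * (c * y) - a * x := by
    simp only [moeb]
    have hne := hDp.ne'
    rw [div_mul_eq_mul_div, div_mul_eq_mul_div, ← sub_div, eq_sub_iff_add_eq, eq_div_iff hne]
    linear_combination (-(c * y ^ 2)) * hdet
  have hYp : 0 < (moeb a b c d x y).2 := by simp only [moeb]; positivity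
  rw [← hinv] at hD'
  set X := (moeb a b c d x y).1
  set Y := (moeb a b c d x y).2
  have h1 : |c * x + d| ≤ ε := abs_le_of_sq_le_sq (by nlinarith [sq_nonneg (c * y)]) (by linarith)
  have h2 : |c * y| ≤ ε := abs_le_of_sq_le_sq (by nlinarith [sq_nonneg (c * x + d)]) (by linarith)
  have h3 : |(-c) * X + a| ≤ ε :=
    abs_le_of_sq_le_sq (by nlinarith [sq_nonneg (c * Y)]) (by linarith)
  have hc1 : |c| ≤ ε / η := by
    rcases hc with rfl | ⟨h, -⟩
    · simp; positivity
    · rw [le_div_iff₀ hη]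
      rw [abs_mul, abs_of_pos hy] at h2
      nlinarith [abs_nonneg c]
  have hYc : |Y * (c * y)| ≤ ε ^ 2 := by
    rcases hc with rfl | ⟨-, h⟩
    · simp; positivity
    · rw [abs_mul, abs_of_pos hYp, sq]
      exact mul_le_mul h h2 (abs_nonneg _) (by linarith)
  have hcx : |c * x| ≤ ε / η * B := by
    rw [abs_mul]; exact mul_le_mul hc1 hx (abs_nonneg _) (by positivity)
  have hcX : |c * X| ≤ ε / η * B := by
    rw [abs_mul]; exact mul_le_mul hc1 hX (abs_nonneg _) (by positivity)
  have ha : |a| ≤ ε + ε / η * B := by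
    have e : a = ((-c) * X + a) + c * X := by ring
    rw [e]
    exact (abs_add_le _ _).trans (by linarith)
  refine ⟨hc1, ?_, ha, ?_⟩
  · have e : d = (c * x + d) - c * x := by ring
    rw [e]
    exact (abs_sub _ _).trans (by linarith)
  · rw [eb]
    have g1 : |X * (c * x + d)| ≤ ε * B := by
      rw [abs_mul, mul_comm]; exact mul_le_mul h1 hX (abs_nonneg _) (by linarith)
    have g2 : |a * x| ≤ (ε + ε / η * B) * B := by
      rw [abs_mul]; exact mul_le_mul ha hx (abs_nonneg _) (by positivity)
    have g3 := abs_sub (X * (c * x + d) - Y * (c * y)) (a * x)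
    have g4 := abs_sub (X * (c * x + d)) (Y * (c * y))
    linarith

theorem aux_xbound (k : ℕ) (hk1 : 1 < k) (ε : ℝ) (p : Pt) (hp : p ∈ FInf k ε) :
    |x1 p| ≤ 1 + |omg k| + |omg' k| ∧ |x2 p| ≤ 1 + |omg k| + |omg' k| := by
  have hd := aux_diff k hk1
  have hne : omg k - omg' k ≠ 0 := by linarith
  have hne' : omg' k - omg k ≠ 0 := by linarith
  obtain ⟨-, h1, h2, -⟩ := hp
  have e1 : x1 p = s1 k p + s2 k p * omg k := by
    have : s1 k p = - (omg' k * x1 p - omg k * x2 p) / (omg k - omg' k) := by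
      rw [s1, ← neg_sub (omg k) (omg' k), div_neg, neg_div]
    rw [this, s2]; field_simp; ring
  have e2 : x2 p = s1 k p + s2 k p * omg' k := by
    have : s1 k p = - (omg' k * x1 p - omg k * x2 p) / (omg k - omg' k) := by
      rw [s1, ← neg_sub (omg k) (omg' k), div_neg, neg_div]
    rw [this, s2]; field_simp; ring
  have a1 := abs_nonneg (omg k)
  have a2 := abs_nonneg (omg' k)
  constructor
  · rw [e1]
    have := aux_absb (w := omg k) h1 h2 (by norm_num) le_rfl
    linarith
  · rw [e2]
    have := aux_absb (w := omg' k) h1 h2 (by norm_num) le_rfl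
    linarith

theorem aux_D {y1 y2 D1 D2 ε : ℝ} (h1 : 0 < y1) (h2 : 0 < y2) (d1 : 0 < D1) (d2 : 0 < D2)
    (hε : 1 < ε) (hD : D1 * D2 = 1) (a1 : (ε ^ 2)⁻¹ ≤ y1 / y2) (a2 : y1 / y2 ≤ ε ^ 2)
    (b1 : (ε ^ 2)⁻¹ ≤ (y1 / D1) / (y2 / D2)) (b2 : (y1 / D1) / (y2 / D2) ≤ ε ^ 2) :
    D1 ≤ ε ^ 2 ∧ D2 ≤ ε ^ 2 := by
  have e2 : 0 < ε ^ 2 := by positivity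
  have hr : 0 < y1 / y2 := by positivity
  have e : (y1 / D1) / (y2 / D2) = (y1 / y2) * D2 ^ 2 := by
    have : D2 = 1 / D1 := by field_simp; linarith
    rw [this]; field_simp
  rw [e] at b1 b2
  set r := y1 / y2
  rw [inv_le_iff_one_le_mul₀' e2] at a1 b1
  have q2 : D2 ^ 2 ≤ (ε ^ 2) ^ 2 := by
    have := mul_le_mul_of_nonneg_left b2 e2.le
    nlinarith [sq_nonneg D2]
  have q1 : D1 ^ 2 ≤ (ε ^ 2) ^ 2 := by
    have h5 : D1 ^ 2 * D2 ^ 2 = 1 := by rw [← mul_pow, hD, one_pow]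
    have h6 := mul_le_mul_of_nonneg_left b1 (sq_nonneg D1)
    have h7 : D1 ^ 2 * (ε ^ 2 * (r * D2 ^ 2)) = ε ^ 2 * r := by linear_combination (ε ^ 2 * r) * h5
    rw [h7] at h6
    nlinarith
  exact ⟨le_of_sq_le_sq q1 e2.le, le_of_sq_le_sq q2 e2.le⟩

theorem aux_up {y1 y2 ε : ℝ} (h1 : 0 < y1) (h2 : 0 < y2) (hε : 1 < ε)
    (hle : (y1 * y2) ^ 2 ≤ 1) (a1 : (ε ^ 2)⁻¹ ≤ y1 / y2) (a2 : y1 / y2 ≤ ε ^ 2) :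
    y1 ≤ ε ∧ y2 ≤ ε := by
  have e2 : 0 < ε ^ 2 := by positivity
  have hle1 : y1 * y2 ≤ 1 := by
    apply le_of_sq_le_sq _ zero_le_one
    simpa using hle
  rw [div_le_iff₀ h2] at a2
  rw [le_div_iff₀ h2, inv_mul_le_iff₀ e2] at a1
  have f := mul_le_mul_of_nonneg_left hle1 e2.le
  constructor
  · apply le_of_sq_le_sq _ (by linarith)
    have := mul_le_mul_of_nonneg_left a2 h1.le
    linarith [sq y1]
  · apply le_of_sq_le_sq _ (by linarith)
    have := mul_le_mul_of_nonneg_left a1 h2.le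
    linarith [sq y2]

/-- If `R` is a principal ideal domain, then `{γ ∈ Γ : F ∩ γ(F) ≠ ∅}` is
finite, i.e. every tile of the tessellation `{γ(F) : γ ∈ Γ}` intersects only finitely many
other tiles. -/
theorem tiles_meeting_F_finite (k : ℕ) (hk : Squarefree k) (hk1 : 1 < k)
    (e : (R k)ˣ) (he : IsFundUnit k e) (hPID : IsPrincipalIdealRing (R k)) :
    {g : SL k | (F k (eps k e) ∩ act k g '' F k (eps k e)).Nonempty}.Finite := by
  have hε : 1 < eps k e := he.1
  set ε := eps k e
  obtain ⟨h0, h0p, hh0⟩ := aux_height k hk hk1 hPID ε hε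
  set B : ℝ := 1 + |omg k| + |omg' k| with hB
  set η := Real.sqrt h0 with hηd
  have hη : 0 < η := Real.sqrt_pos.2 h0p
  have hBp : 0 < B := by positivity
  set M : ℝ := ε / η + (ε + ε / η * B) + (ε * B + ε ^ 2 + (ε + ε / η * B) * B) with hM
  have hfin := aux_fin k hk1 M
  set T := {a : R k | |(a : ℝ × ℝ).1| ≤ M ∧ |(a : ℝ × ℝ).2| ≤ M} with hT
  have hpi : {A : Fin 2 → Fin 2 → R k | ∀ i j, A i j ∈ T}.Finite := by
    have := Set.Finite.pi (t := fun _ : Fin 2 => Set.pi Set.univ (fun _ : Fin 2 => T))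
      (fun _ => Set.Finite.pi (fun _ => hfin))
    refine this.subset ?_
    intro A hA i _ j _
    exact hA i j
  have hpre := hpi.preimage (f := fun g : SL k => (fun i j => g.1 i j))
    (by
      intro g _ g' _ h
      apply Subtype.ext
      exact h)
  refine hpre.subset ?_
  rintro g ⟨p, hpF, q, hqF, hpq⟩
  have hdet : g.1 0 0 * g.1 1 1 - g.1 0 1 * g.1 1 0 = 1 := by
    rw [← Matrix.det_fin_two]; exact g.2
  have hcdef : ∀ c : R k, c = g.1 1 0 → c = 0 ∨ c ≠ 0 := fun c _ => em _
  simp only [act] at hpq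
  have hxq := aux_xbound k hk1 ε q hqF.1
  have hxp := aux_xbound k hk1 ε p hpF.1
  have hyq := hh0 q hqF
  obtain ⟨⟨⟨hqy1, hqy2⟩, -, -, hqr1, hqr2⟩, hq0⟩ := hqF
  obtain ⟨⟨⟨hpy1, hpy2⟩, -, -, hpr1, hpr2⟩, hp0⟩ := hpF
  suffices hs : (∀ j : Fin 2, True) ∧ g.1 0 0 ∈ T ∧ g.1 0 1 ∈ T ∧ g.1 1 0 ∈ T ∧ g.1 1 1 ∈ T by
    obtain ⟨-, t1, t2, t3, t4⟩ := hs
    simp only [Set.mem_preimage, Set.mem_ofPred_eq]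
    intro i j
    fin_cases i <;> fin_cases j
    · exact t1
    · exact t2
    · exact t3
    · exact t4
  refine ⟨fun _ => trivial, ?_⟩
  have hS : (g.1 1 0, g.1 1 1) ∈ Spairs k := by
    simp only [Spairs, Set.mem_ofPred_eq]
    rw [Ideal.eq_top_iff_one]
    exact Ideal.mem_span_pair.2 ⟨-g.1 0 1, g.1 0 0, by linear_combination hdet⟩
  have hS' : (-g.1 1 0, g.1 0 0) ∈ Spairs k := by
    simp only [Spairs, Set.mem_ofPred_eq]
    rw [Ideal.eq_top_iff_one]
    exact Ideal.mem_span_pair.2 ⟨g.1 0 1, g.1 1 1, by linear_combination hdet⟩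
  have hn := hq0.2 _ hS
  have hn' := hp0.2 _ hS'
  have det1 := congrArg (fun z : R k => (z : ℝ × ℝ).1) hdet
  have det2 := congrArg (fun z : R k => (z : ℝ × ℝ).2) hdet
  have hcc : g.1 1 0 = 0 ∨ ((g.1 1 0 : R k) : ℝ × ℝ).1 ≠ 0 ∧ ((g.1 1 0 : R k) : ℝ × ℝ).2 ≠ 0 ∧
      1 ≤ (((g.1 1 0 : R k) : ℝ × ℝ).1 * ((g.1 1 0 : R k) : ℝ × ℝ).2) ^ 2 := by
    by_cases h : g.1 1 0 = 0
    · exact Or.inl h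
    · exact Or.inr (aux_ne k hk hk1 _ h)
  simp only [HNorm] at hn hn'
  simp only [AddSubgroupClass.coe_sub, Subring.coe_mul, Prod.fst_sub, Prod.snd_sub, Prod.fst_mul,
    Prod.snd_mul, OneMemClass.coe_one, Prod.fst_one, Prod.snd_one] at det1 det2
  simp only [NegMemClass.coe_neg, Prod.fst_neg, Prod.snd_neg] at hn'
  simp only [hT, Set.mem_ofPred_eq]
  have hcz : g.1 1 0 = 0 → ((g.1 1 0 : R k) : ℝ × ℝ).1 = 0 ∧ ((g.1 1 0 : R k) : ℝ × ℝ).2 = 0 := by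
    intro h; rw [h]; simp
  replace hcc : (((g.1 1 0 : R k) : ℝ × ℝ).1 = 0 ∧ ((g.1 1 0 : R k) : ℝ × ℝ).2 = 0) ∨
      1 ≤ (((g.1 1 0 : R k) : ℝ × ℝ).1 * ((g.1 1 0 : R k) : ℝ × ℝ).2) ^ 2 :=
    hcc.imp hcz (fun h => h.2.2)
  clear hcz hcdef hS hS' hdet
  generalize ((g.1 0 0 : R k) : ℝ × ℝ) = a at *
  generalize ((g.1 0 1 : R k) : ℝ × ℝ) = b at *
  generalize ((g.1 1 0 : R k) : ℝ × ℝ) = c at *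
  generalize ((g.1 1 1 : R k) : ℝ × ℝ) = d at *
  have ex1 : x1 p = (moeb a.1 b.1 c.1 d.1 (x1 q) (y1 q)).1 := by rw [← hpq]; rfl
  have ex2 : x2 p = (moeb a.2 b.2 c.2 d.2 (x2 q) (y2 q)).1 := by rw [← hpq]; rfl
  have ey1 : y1 p = (moeb a.1 b.1 c.1 d.1 (x1 q) (y1 q)).2 := by rw [← hpq]; rfl
  have ey2 : y2 p = (moeb a.2 b.2 c.2 d.2 (x2 q) (y2 q)).2 := by rw [← hpq]; rfl
  have D1p := aux_den (x := x1 q) hqy1 det1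
  have D2p := aux_den (x := x2 q) hqy2 det2
  rw [ex1, ex2, ey1, ey2, aux_inv hqy1 det1, aux_inv hqy2 det2] at hn'
  have ey1' : y1 p = y1 q / ((c.1 * x1 q + d.1) ^ 2 + c.1 ^ 2 * y1 q ^ 2) := ey1
  have ey2' : y2 p = y2 q / ((c.2 * x2 q + d.2) ^ 2 + c.2 ^ 2 * y2 q ^ 2) := ey2
  have hDD : ((c.1 * x1 q + d.1) ^ 2 + c.1 ^ 2 * y1 q ^ 2) *
      ((c.2 * x2 q + d.2) ^ 2 + c.2 ^ 2 * y2 q ^ 2) = 1 := by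
    apply le_antisymm _ hn
    rw [div_mul_div_comm, one_mul, le_div_iff₀ (by positivity)] at hn'
    linarith
  rw [rr] at hqr1 hqr2
  rw [rr, ey1', ey2'] at hpr1 hpr2
  obtain ⟨B1, B2⟩ := aux_D hqy1 hqy2 D1p D2p hε hDD hqr1 hqr2 hpr1 hpr2
  have I1 : 1 / ((c.1 * x1 q + d.1) ^ 2 + c.1 ^ 2 * y1 q ^ 2) =
      (c.2 * x2 q + d.2) ^ 2 + c.2 ^ 2 * y2 q ^ 2 := by
    rw [div_eq_iff D1p.ne']; linarith
  have I2 : 1 / ((c.2 * x2 q + d.2) ^ 2 + c.2 ^ 2 * y2 q ^ 2) =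
      (c.1 * x1 q + d.1) ^ 2 + c.1 ^ 2 * y1 q ^ 2 := by
    rw [div_eq_iff D2p.ne']; linarith
  have hyl1 : η ≤ y1 q := Real.sqrt_le_iff.2 ⟨hqy1.le, hyq.1⟩
  have hyl2 : η ≤ y2 q := Real.sqrt_le_iff.2 ⟨hqy2.le, hyq.2⟩
  have hup : 1 ≤ (c.1 * c.2) ^ 2 → y1 p ≤ ε ∧ y2 p ≤ ε := by
    intro hc
    have hprod : y1 p * y2 p = y1 q * y2 q := by
      rw [ey1', ey2', div_mul_div_comm, hDD, div_one]
    have hle : (y1 q * y2 q) ^ 2 ≤ 1 := by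
      have h1 : (c.1 ^ 2 * y1 q ^ 2) * (c.2 ^ 2 * y2 q ^ 2) ≤ 1 := by
        rw [← hDD]
        exact mul_le_mul (by linarith [sq_nonneg (c.1 * x1 q + d.1)])
          (by linarith [sq_nonneg (c.2 * x2 q + d.2)]) (by positivity) D1p.le
      have h2 : (c.1 ^ 2 * y1 q ^ 2) * (c.2 ^ 2 * y2 q ^ 2) =
          (c.1 * c.2) ^ 2 * (y1 q * y2 q) ^ 2 := by ring
      rw [h2] at h1
      exact (le_mul_of_one_le_left (sq_nonneg _) hc).trans h1
    rw [← hprod] at hle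
    rw [← ey1', ← ey2'] at hpr1 hpr2
    exact aux_up hpy1 hpy2 hε hle hpr1 hpr2
  rw [ex1, ex2] at hxp
  have r1 := aux_entries hqy1 hη hε det1 hxq.1 hxp.1 B1 (I1 ▸ B2)
    (hcc.imp (fun h => h.1) (fun h => ⟨hyl1, ey1 ▸ (hup h).1⟩))
  have r2 := aux_entries hqy2 hη hε det2 hxq.2 hxp.2 B2 (I2 ▸ B1)
    (hcc.imp (fun h => h.2) (fun h => ⟨hyl2, ey2 ▸ (hup h).2⟩))
  have z1 : 0 ≤ ε / η := by positivity
  have z2 : 0 ≤ ε / η * B := by positivity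
  have z3 : 0 ≤ (ε + ε / η * B) * B := by positivity
  have z4 : 0 ≤ ε * B := by positivity
  have z5 : 0 ≤ ε ^ 2 := by positivity
  refine ⟨⟨?_, ?_⟩, ⟨?_, ?_⟩, ⟨?_, ?_⟩, ⟨?_, ?_⟩⟩ <;> linarith [r1.1, r1.2.1, r1.2.2.1, r1.2.2.2, r2.1, r2.2.1, r2.2.2.1, r2.2.2.2]

end Hilbert
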